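/- Let λ ∈ ℝ \ {0, 1/2, 1}, μ ∈ ℝ, and let A^{ij} = A^{ji}, A^i, A be smooth real functions on ℝⁿ. Let (S^{ij}, γ^i, θ) be given by S^{ij} = 2A^{ij}, γ^i = (2A^i − ∂_j S^{ji})/(2λ−1), θ = (2A − λ∂_iγ^i)/(λ(λ−1)), so that the canonical pencil of weight δ = 0, Δ_ν f = (1/2)(S^{ij}∂_i∂_j f + (∂_j S^{ji})∂_i f + (2ν−1)γ^i∂_i f + ν(∂_iγ^i)f + ν(ν−1)θ f), satisfies Δ_λ f = A^{ij}∂_i∂_j f + A^i∂_i f + A·f. Then Δ_μ f = B^{ij}∂_i∂_j f + B^i∂_i f + B·f, where B^{ij} = A^{ij}, B^i = ((2μ−1)/(2λ−1))A^i + (2(λ−μ)/(2λ−1))∂_j A^{ji}, and B = (μ(μ−1)/(λ(λ−1)))A + (μ(λ−μ)/((2λ−1)(λ−1)))(∂_j A^j − ∂_i∂_j A^{ij}). -/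

import Mathlib

open MeasureTheory Real

/-- Partial derivative of a function on ℝⁿ in the direction of the `i`-th coordinate. -/
noncomputable def pd {n : ℕ} (a : Fin n) (f : (Fin n → ℝ) → ℝ) : (Fin n → ℝ) → ℝ :=
  fun x => fderiv ℝ f x (Pi.single a 1)

/-- The canonical pencil operator of weight `δ` with data `(S, γ, θ)`. -/
noncomputable def pencil {n : ℕ} (δ lam : ℝ) (S : Fin n → Fin n → (Fin n → ℝ) → ℝ)
    (γ : Fin n → (Fin n → ℝ) → ℝ) (θ : (Fin n → ℝ) → ℝ)
    (f : (Fin n → ℝ) → ℝ) (x : Fin n → ℝ) : ℝ :=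
  (1/2) * (∑ a, ∑ b, S a b x * pd a (pd b f) x
    + ∑ a, (∑ b, pd b (S b a) x) * pd a f x
    + (2*lam + δ - 1) * ∑ a, γ a x * pd a f x
    + lam * (∑ a, pd a (γ a) x) * f x
    + lam * (lam + δ - 1) * θ x * f x)

lemma ContDiff.pd {n : ℕ} {f : (Fin n → ℝ) → ℝ} (hf : ContDiff ℝ (⊤ : ℕ∞) f) (a : Fin n) :
    ContDiff ℝ (⊤ : ℕ∞) (_root_.pd a f) :=
  (hf.fderiv_right (m := (⊤ : ℕ∞)) (by exact_mod_cast le_top)).clm_apply contDiff_const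

lemma pd_const_mul {n : ℕ} (a : Fin n) (c : ℝ) {f : (Fin n → ℝ) → ℝ} {x : Fin n → ℝ}
    (hf : DifferentiableAt ℝ f x) : pd a (fun y => c * f y) x = c * pd a f x := by
  simp [pd, fderiv_const_mul hf c]

lemma pd_sub {n : ℕ} (a : Fin n) {f g : (Fin n → ℝ) → ℝ} {x : Fin n → ℝ}
    (hf : DifferentiableAt ℝ f x) (hg : DifferentiableAt ℝ g x) :
    pd a (fun y => f y - g y) x = pd a f x - pd a g x := by
  simp [pd, fderiv_fun_sub hf hg]

lemma pd_sum {n : ℕ} {ι : Type*} (s : Finset ι) (a : Fin n) {f : ι → (Fin n → ℝ) → ℝ}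
    {x : Fin n → ℝ} (hf : ∀ i ∈ s, DifferentiableAt ℝ (f i) x) :
    pd a (fun y => ∑ i ∈ s, f i y) x = ∑ i ∈ s, pd a (f i) x := by
  simp [pd, fderiv_fun_sum hf]

/-- the Duval–Ovsienko intertwining map: drawing the unique canonical pencil
of weight `δ = 0` through an operator on densities of weight `λ` and specializing it to
the weight `μ` produces the operator with the stated coefficients `B^{ij}, B^i, B`. -/
theorem statement6 (n : ℕ) (lam mu : ℝ)
    (hlam0 : lam ≠ 0) (hlamhalf : lam ≠ 1/2) (hlam1 : lam ≠ 1)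
    (A2 : Fin n → Fin n → (Fin n → ℝ) → ℝ) (A1 : Fin n → (Fin n → ℝ) → ℝ)
    (A0 : (Fin n → ℝ) → ℝ)
    (hA2 : ∀ i j, ContDiff ℝ (⊤ : ℕ∞) (A2 i j)) (hA2symm : ∀ i j, A2 i j = A2 j i)
    (hA1 : ∀ i, ContDiff ℝ (⊤ : ℕ∞) (A1 i)) (hA0 : ContDiff ℝ (⊤ : ℕ∞) A0)
    (S : Fin n → Fin n → (Fin n → ℝ) → ℝ) (γ : Fin n → (Fin n → ℝ) → ℝ)
    (θ : (Fin n → ℝ) → ℝ)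
    (hS : ∀ i j x, S i j x = 2 * A2 i j x)
    (hγ : ∀ i x, γ i x = (2 * A1 i x - ∑ j, pd j (S j i) x) / (2*lam - 1))
    (hθ : ∀ x, θ x = (2 * A0 x - lam * ∑ i, pd i (γ i) x) / (lam * (lam - 1))) :
    ∀ f : (Fin n → ℝ) → ℝ, ContDiff ℝ (⊤ : ℕ∞) f → ∀ x,
      -- the pencil passes through Δ_λ = A:
      (pencil 0 lam S γ θ f x
        = ∑ i, ∑ j, A2 i j x * pd i (pd j f) x + ∑ i, A1 i x * pd i f x + A0 x * f x)
      ∧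
      -- and its value at μ is the Duval–Ovsienko image B of A:
      (pencil 0 mu S γ θ f x
        = ∑ i, ∑ j, A2 i j x * pd i (pd j f) x
          + ∑ i, (((2*mu - 1)/(2*lam - 1)) * A1 i x
              + (2*(lam - mu)/(2*lam - 1)) * ∑ j, pd j (A2 j i) x) * pd i f x
          + ((mu*(mu - 1)/(lam*(lam - 1))) * A0 x
              + (mu*(lam - mu)/((2*lam - 1)*(lam - 1))) *
                ((∑ j, pd j (A1 j) x) - ∑ i, ∑ j, pd i (pd j (A2 i j)) x)) * f x) := by
  have hd : 2 * lam - 1 ≠ 0 := fun h => hlamhalf (by linarith)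
  have hl : lam - 1 ≠ 0 := sub_ne_zero.2 hlam1
  have diff {g : (Fin n → ℝ) → ℝ} (hg : ContDiff ℝ (⊤ : ℕ∞) g) (x) : DifferentiableAt ℝ g x :=
    hg.differentiable (by simp) x
  have hdS (i j k x) : pd k (S i j) x = 2 * pd k (A2 i j) x := by
    rw [show S i j = fun y => 2 * A2 i j y from funext (hS i j), pd_const_mul k 2 (diff (hA2 i j) x)]
  have hγ' (i x) : γ i x = 2 / (2 * lam - 1) * (A1 i x - ∑ j, pd j (A2 j i) x) := by
    simp only [hγ, hdS, ← Finset.mul_sum]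
    ring
  have hdγ (i x) : pd i (γ i) x
      = 2 / (2 * lam - 1) * (pd i (A1 i) x - ∑ j, pd i (pd j (A2 i j)) x) := by
    have hsum : DifferentiableAt ℝ (fun y => ∑ j, pd j (A2 j i) y) x :=
      DifferentiableAt.fun_sum fun j _ => diff ((hA2 j i).pd j) x
    rw [funext (hγ' i), pd_const_mul i _ ((diff (hA1 i) x).fun_sub hsum),
      pd_sub i (diff (hA1 i) x) hsum, pd_sum _ i fun j _ => diff ((hA2 j i).pd j) x]
    simp only [hA2symm i]
  intro f _ x
  have key (ν : ℝ) : pencil 0 ν S γ θ f x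
      = ∑ i, ∑ j, A2 i j x * pd i (pd j f) x
        + ∑ i, (((2*ν - 1)/(2*lam - 1)) * A1 i x
            + (2*(lam - ν)/(2*lam - 1)) * ∑ j, pd j (A2 j i) x) * pd i f x
        + ((ν*(ν - 1)/(lam*(lam - 1))) * A0 x
            + (ν*(lam - ν)/((2*lam - 1)*(lam - 1))) *
              ((∑ j, pd j (A1 j) x) - ∑ i, ∑ j, pd i (pd j (A2 i j)) x)) * f x := by
    have h1 : ∑ i, (((2*ν - 1)/(2*lam - 1)) * A1 i x
            + (2*(lam - ν)/(2*lam - 1)) * ∑ j, pd j (A2 j i) x) * pd i f x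
        = (2*ν - 1)/(2*lam - 1) * ∑ i, A1 i x * pd i f x
          + 2*(lam - ν)/(2*lam - 1) * ∑ i, (∑ j, pd j (A2 j i) x) * pd i f x := by
      rw [Finset.mul_sum, Finset.mul_sum, ← Finset.sum_add_distrib]
      exact Finset.sum_congr rfl fun i _ => by ring
    rw [h1]
    simp only [pencil, hθ, hS, hdS, hdγ, hγ', mul_assoc, sub_mul, ← Finset.mul_sum,
      Finset.sum_sub_distrib]
    field_simp
    ring
  refine ⟨?_, key mu⟩
  rw [key lam]
  simp [hd, hl, hlam0]
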